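/- arXiv:1710.07561 — 3 statements merged into one kernel-verified Lean document; each statement's English description precedes it below -/
import Mathlib

section
/- Let {x_k}_{k=1}^m be a frame for a real or complex n-dimensional Hilbert space H^n. The following are equivalent: (1) {x_k}_{k=1}^m is injective; (2) for every orthonormal basis {e_j}_{j=1}^n of H^n, the vectors (|⟨x_k, e_1⟩|², |⟨x_k, e_2⟩|², …, |⟨x_k, e_n⟩|²) for k = 1,…,m span ℝⁿ. -/
/-- The quadratic form of an operator diagonal in an orthonormal basis. -/
theorem quad_diag {𝕜 H : Type} [RCLike 𝕜] [NormedAddCommGroup H]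
    [InnerProductSpace 𝕜 H] {n : ℕ} (e : OrthonormalBasis (Fin n) 𝕜 H) (T : H →L[𝕜] H)
    (c : Fin n → ℝ) (hT : ∀ j, T (e j) = (c j : 𝕜) • e j) (v : H) :
    (inner 𝕜 (T v) v : 𝕜) = ((∑ j, ‖(inner 𝕜 v (e j) : 𝕜)‖ ^ 2 * c j : ℝ) : 𝕜) := by
  have h : T v = ∑ j, (inner 𝕜 (e j) v : 𝕜) • (c j : 𝕜) • e j := by
    conv_lhs => rw [← e.sum_repr' v]
    simp [map_sum, hT]
  rw [h, sum_inner]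
  push_cast
  refine Finset.sum_congr rfl fun j _ => ?_
  rw [inner_smul_left, inner_smul_left, inner_conj_symm, RCLike.conj_ofReal,
    ← RCLike.mul_conj, inner_conj_symm]
  ring

/-- A frame `{x_k}_{k=1}^m` for a real or complex `n`-dimensional
Hilbert space is injective if and only if for every orthonormal basis
`{e_j}_{j=1}^n`, the vectors `(|⟨x_k, e_1⟩|², …, |⟨x_k, e_n⟩|²)`, `k = 1,…,m`,
span `ℝⁿ`. -/
theorem stmt_6 {𝕜 H : Type} [RCLike 𝕜] [NormedAddCommGroup H]
    [InnerProductSpace 𝕜 H] [FiniteDimensional 𝕜 H] [CompleteSpace H]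
    {n m : ℕ} (hdim : Module.finrank 𝕜 H = n) (x : Fin m → H)
    (hframe : ∃ A B : ℝ, 0 < A ∧ A ≤ B ∧ ∀ v : H,
      A * ‖v‖ ^ 2 ≤ ∑ k, ‖(inner 𝕜 v (x k) : 𝕜)‖ ^ 2 ∧
      ∑ k, ‖(inner 𝕜 v (x k) : 𝕜)‖ ^ 2 ≤ B * ‖v‖ ^ 2) :
    ((∀ T : H →L[𝕜] H, IsSelfAdjoint T →
        (∀ k, (inner 𝕜 (T (x k)) (x k) : 𝕜) = 0) → T = 0) ↔
      (∀ e : OrthonormalBasis (Fin n) 𝕜 H,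
        Submodule.span ℝ
          (Set.range fun k => (fun j => ‖(inner 𝕜 (x k) (e j) : 𝕜)‖ ^ 2 : Fin n → ℝ)) = ⊤)) := by
  clear hframe
  constructor
  · intro hinj e
    by_contra hne
    obtain ⟨f, hf, hle⟩ := Submodule.exists_le_ker_of_lt_top _ (lt_top_iff_ne_top.mpr hne)
    let c : Fin n → ℝ := fun j => f (Pi.single j 1)
    have hfc : ∀ v : Fin n → ℝ, f v = ∑ j, v j * c j := by
      intro v
      rw [LinearMap.pi_apply_eq_sum_univ f v]
      refine Finset.sum_congr rfl fun j _ => ?_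
      simp only [c, smul_eq_mul]
      congr 2
      ext i
      simp [Pi.single_apply, eq_comm]
    let T : H →L[𝕜] H := ∑ j, (c j : 𝕜) • InnerProductSpace.rankOne 𝕜 (e j) (e j)
    have hTe : ∀ j, T (e j) = (c j : 𝕜) • e j := by
      intro j
      simp [T, ContinuousLinearMap.sum_apply, e.inner_eq_ite]
    have hTs : IsSelfAdjoint T := by
      rw [ContinuousLinearMap.isSelfAdjoint_iff_isSymmetric]
      intro v w
      simp only [T, ContinuousLinearMap.coe_coe, ContinuousLinearMap.sum_apply, sum_inner,
        inner_sum, ContinuousLinearMap.smul_apply, InnerProductSpace.rankOne_apply,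
        inner_smul_left, inner_smul_right, RCLike.conj_ofReal, inner_conj_symm]
      refine Finset.sum_congr rfl fun j _ => ?_
      ring
    have hT0 : T = 0 := by
      refine hinj T hTs fun k => ?_
      rw [quad_diag e T c hTe]
      have := hle (Submodule.subset_span ⟨k, rfl⟩)
      rw [LinearMap.mem_ker, hfc] at this
      rw [this, RCLike.ofReal_zero]
    apply hf
    refine LinearMap.ext fun v => ?_
    rw [hfc, LinearMap.zero_apply]
    refine Finset.sum_eq_zero fun j _ => ?_
    have hj := hTe j
    rw [hT0, ContinuousLinearMap.zero_apply, eq_comm, smul_eq_zero] at hj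
    rcases hj with hj | hj
    · rw [RCLike.ofReal_eq_zero.mp hj, mul_zero]
    · exact absurd hj (e.orthonormal.ne_zero j)
  · intro hspan T hT hq
    have hs := ContinuousLinearMap.isSelfAdjoint_iff_isSymmetric.mp hT
    let e := hs.eigenvectorBasis hdim
    let c := hs.eigenvalues hdim
    have hTe : ∀ j, T (e j) = (c j : 𝕜) • e j := fun j => hs.apply_eigenvectorBasis hdim j
    let f : (Fin n → ℝ) →ₗ[ℝ] ℝ := ∑ j, c j • LinearMap.proj j
    have hf : ∀ v, f v = ∑ j, v j * c j := by
      intro v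
      simp [f, mul_comm]
    have hker : (⊤ : Submodule ℝ (Fin n → ℝ)) ≤ LinearMap.ker f := by
      rw [← hspan e, Submodule.span_le]
      rintro _ ⟨k, rfl⟩
      rw [SetLike.mem_coe, LinearMap.mem_ker, hf]
      have := hq k
      rw [quad_diag e T c hTe] at this
      exact RCLike.ofReal_eq_zero.mp this
    have hc : ∀ j, c j = 0 := by
      intro j
      have := hker (Submodule.mem_top (x := Pi.single j 1))
      rw [LinearMap.mem_ker, hf] at this
      simpa [Pi.single_apply] using this
    apply ContinuousLinearMap.coe_injective
    refine e.toBasis.ext fun j => ?_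
    simp [hTe, hc]
end

section
/- Let {x_k}_{k=1}^∞ be a family of vectors in an infinite-dimensional real or complex Hilbert space H. The following are equivalent: (1) whenever T and S are Hilbert–Schmidt positive self-adjoint operators on H with ⟨T x_k, x_k⟩ = ⟨S x_k, x_k⟩ for all k, then T = S; (2) whenever T and S are Hilbert–Schmidt self-adjoint operators on H with ⟨T x_k, x_k⟩ = ⟨S x_k, x_k⟩ for all k, then T = S; (3) the family {x_k}_{k=1}^∞ is injective. -/
/-- `T` is a Hilbert–Schmidt operator: `Σ_i ‖T e_i‖² < ∞` for some
(equivalently, every) orthonormal (Hilbert) basis `{e_i}`. -/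
def IsHilbertSchmidt {𝕜 H : Type} [RCLike 𝕜] [NormedAddCommGroup H]
    [InnerProductSpace 𝕜 H] (T : H →L[𝕜] H) : Prop :=
  ∃ (ι : Type) (e : HilbertBasis ι 𝕜 H), Summable fun i => ‖T (e i)‖ ^ 2

section
variable {𝕜 H : Type} [RCLike 𝕜] [NormedAddCommGroup H] [InnerProductSpace 𝕜 H]

theorem hasSum_sq_norm {ι : Type} (e : HilbertBasis ι 𝕜 H) (v : H) :
    HasSum (fun i => ‖(inner 𝕜 (e i) v : 𝕜)‖ ^ 2) (‖v‖ ^ 2) := by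
  have h := (e.hasSum_inner_mul_inner v v).mapL (RCLike.reCLM (K := 𝕜))
  have h2 : RCLike.reCLM (K := 𝕜) (inner 𝕜 v v) = ‖v‖ ^ 2 := by
    simp
  rw [h2] at h
  refine h.congr_fun fun i => ?_
  rw [← inner_conj_symm v (e i), RCLike.conj_mul]
  rw [← RCLike.ofReal_pow]
  exact (RCLike.ofReal_re _).symm

theorem summable_other [CompleteSpace H] {ι κ : Type} (e : HilbertBasis ι 𝕜 H) (f : HilbertBasis κ 𝕜 H)
    (T : H →L[𝕜] H) (hT : IsSelfAdjoint T)
    (h : Summable fun i => ‖T (e i)‖ ^ 2) : Summable fun j => ‖T (f j)‖ ^ 2 := by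
  have hs : (T : H →ₗ[𝕜] H).IsSymmetric := hT.isSymmetric
  have key : Summable fun p : ι × κ => ‖(inner 𝕜 (f p.2) (T (e p.1)) : 𝕜)‖ ^ 2 := by
    refine (summable_prod_of_nonneg (fun p => sq_nonneg _)).2 ?_
    refine ⟨fun i => (hasSum_sq_norm f (T (e i))).summable, ?_⟩
    exact h.congr fun i => (hasSum_sq_norm f (T (e i))).tsum_eq.symm
  have key2 := key.prod_symm
  refine ((summable_prod_of_nonneg (fun p => sq_nonneg _)).1 key2).2.congr fun j => ?_
  rw [← (hasSum_sq_norm e (T (f j))).tsum_eq]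
  refine tsum_congr fun i => ?_
  have := hs (e i) (f j)
  simp only [ContinuousLinearMap.coe_coe] at this
  simp only [Prod.swap]
  rw [← this, norm_inner_symm]

theorem hs_compact [CompleteSpace H] {ι : Type} (e : HilbertBasis ι 𝕜 H)
    (T : H →L[𝕜] H) (h : Summable fun i => ‖T (e i)‖ ^ 2) : IsCompactOperator T := by
  classical
  let A : ι → H →L[𝕜] H := fun i => (innerSL 𝕜 (e i)).smulRight (T (e i))
  have hA : ∀ i x, A i x = (inner 𝕜 (e i) x : 𝕜) • T (e i) := fun i x => by simp [A]
  have hAc : ∀ i, IsCompactOperator (A i) := fun i => by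
    have : IsCompactOperator (innerSL 𝕜 (e i)) :=
      isCompactOperator_of_locallyCompactSpace_dom _
    exact this.clm_comp (ContinuousLinearMap.toSpanSingleton 𝕜 (T (e i)))
  have hAs : ∀ s : Finset ι, IsCompactOperator (∑ i ∈ s, A i : H →L[𝕜] H) := fun s => by
    induction s using Finset.induction_on with
    | empty => simpa using isCompactOperator_zero
    | insert a s ha ih => rw [Finset.sum_insert ha]; exact (hAc a).add ih
  have bd : ∀ s : Finset ι, ‖∑ i ∈ s, A i‖ ≤ √(∑ i ∈ s, ‖T (e i)‖ ^ 2) := fun s => by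
    refine ContinuousLinearMap.opNorm_le_bound _ (Real.sqrt_nonneg _) fun x => ?_
    rw [sum_apply]
    calc ‖∑ i ∈ s, A i x‖ ≤ ∑ i ∈ s, ‖T (e i)‖ * ‖(inner 𝕜 (e i) x : 𝕜)‖ := by
          refine (norm_sum_le _ _).trans (Finset.sum_le_sum fun i _ => ?_)
          rw [hA, norm_smul, mul_comm]
      _ ≤ √(∑ i ∈ s, ‖T (e i)‖ ^ 2) * √(∑ i ∈ s, ‖(inner 𝕜 (e i) x : 𝕜)‖ ^ 2) :=
          Real.sum_mul_le_sqrt_mul_sqrt _ _ _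
      _ ≤ _ := by
          gcongr
          exact Real.sqrt_le_iff.2 ⟨norm_nonneg _, e.orthonormal.sum_inner_products_le x⟩
  have hsum : Summable A := by
    rw [summable_iff_vanishing_norm] at h ⊢
    intro ε hε
    obtain ⟨s, hs⟩ := h (ε ^ 2) (by positivity)
    refine ⟨s, fun t ht => (bd t).trans_lt ?_⟩
    rw [Real.sqrt_lt' hε]
    exact (Real.le_norm_self _).trans_lt (hs t ht)
  have hT : ∑' i, A i = T := by
    ext x
    have h1 := hsum.hasSum.mapL (ContinuousLinearMap.apply 𝕜 H x)
    have h2 := (e.hasSum_repr x).mapL T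
    refine h1.unique ?_
    convert h2 using 2 with i
    simp [hA, e.repr_apply_apply]
  have := hsum.hasSum
  rw [hT] at this
  exact isCompactOperator_of_tendsto this (Filter.Eventually.of_forall hAs)

open Module.End in
theorem decomp [CompleteSpace H] (T : H →L[𝕜] H) (hT : IsSelfAdjoint T) (hc : IsCompactOperator T) :
    ∃ P : H →L[𝕜] H, (∀ x, ‖P x‖ ≤ ‖x‖) ∧ T ∘L P = P ∘L T ∧ (T ∘L P).IsPositive ∧
      (T ∘L P - T).IsPositive := by
  classical
  have hs : (T : H →ₗ[𝕜] H).IsSymmetric := hT.isSymmetric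
  have hd := ContinuousLinearMap.orthogonalComplement_iSup_eigenspaces_eq_bot hc hs
  rw [← Submodule.topologicalClosure_eq_top_iff] at hd
  set E : 𝕜 → Submodule 𝕜 H := fun μ => eigenspace (T : Module.End 𝕜 H) μ with hE
  let K : Submodule 𝕜 H := (⨆ μ : {μ : 𝕜 // 0 < RCLike.re μ}, E μ).topologicalClosure
  let P := K.starProjection
  have hTE : ∀ μ, ∀ v ∈ E μ, T v = μ • v := fun μ v hv => mem_eigenspace_iff.1 hv
  have hP1 : ∀ μ, 0 < RCLike.re μ → ∀ v ∈ E μ, P v = v := fun μ h v hv => by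
    refine Submodule.starProjection_eq_self_iff.2 ?_
    exact Submodule.le_topologicalClosure _ (Submodule.mem_iSup_of_mem (⟨μ, h⟩ : {μ : 𝕜 // 0 < RCLike.re μ}) hv)
  have hP0 : ∀ μ, ¬ 0 < RCLike.re μ → ∀ v ∈ E μ, P v = 0 := fun μ h v hv => by
    refine (Submodule.starProjection_apply_eq_zero_iff _).2 ?_
    rw [Submodule.orthogonal_closure, ← Submodule.iInf_orthogonal, Submodule.mem_iInf]
    rintro ⟨ν, hν⟩ w hw
    exact hs.orthogonalFamily_eigenspaces (i := ν) (j := μ) (by rintro rfl; exact h hν) ⟨w, hw⟩ ⟨v, hv⟩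
  have hdense : Dense ((⨆ μ, E μ : Submodule 𝕜 H) : Set H) :=
    (Submodule.dense_iff_topologicalClosure_eq_top).2 hd
  have hcomm : T ∘L P = P ∘L T := by
    have : (⨆ μ, E μ) ≤ LinearMap.eqLocus ((T ∘L P : H →L[𝕜] H) : H →ₗ[𝕜] H) ((P ∘L T : H →L[𝕜] H) : H →ₗ[𝕜] H) := by
      refine iSup_le fun μ v hv => ?_
      show T (P v) = P (T v)
      by_cases h : 0 < RCLike.re μ
      · simp [hP1 μ h v hv, hTE μ v hv]
      · simp [hP0 μ h v hv, hTE μ v hv]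
    ext x
    exact congrFun (Continuous.ext_on hdense (T ∘L P).continuous (P ∘L T).continuous this) x
  have hPs : IsSelfAdjoint P := isSelfAdjoint_starProjection K
  have hTP : IsSelfAdjoint (T ∘L P) :=
    (hT.commute_iff hPs).1 hcomm
  have pos : ∀ B : H →L[𝕜] H, ∀ c : 𝕜 → 𝕜, (∀ μ, 0 ≤ RCLike.re (c μ)) →
      (∀ μ, ∀ v ∈ E μ, B v = c μ • v) → ∀ x, 0 ≤ B.reApplyInnerSelf x := by
    intro B c hc hB x
    have hcl : IsClosed {x | 0 ≤ B.reApplyInnerSelf x} :=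
      isClosed_le continuous_const B.reApplyInnerSelf_continuous
    refine hcl.closure_subset_iff.2 ?_ (hdense x)
    intro y hy
    obtain ⟨f, rfl⟩ := (Submodule.mem_iSup_iff_exists_dfinsupp' E y).1 hy
    simp only [Set.mem_ofPred_eq, ContinuousLinearMap.reApplyInnerSelf_apply, DFinsupp.sum]
    rw [map_sum]
    have h1 := hs.orthogonalFamily_eigenspaces.inner_sum (fun μ => c μ • f μ) (fun μ => f μ) f.support
    have h2 : ∑ μ ∈ f.support, B (f μ : H) = ∑ μ ∈ f.support, (E μ).subtypeₗᵢ (c μ • f μ) :=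
      Finset.sum_congr rfl fun μ _ => by simpa using hB μ _ (f μ).2
    rw [h2]
    refine le_of_le_of_eq ?_ (congrArg RCLike.re h1.symm)
    rw [map_sum]
    refine Finset.sum_nonneg fun μ _ => ?_
    rw [inner_smul_left, inner_self_eq_norm_sq_to_K, ← RCLike.ofReal_pow, RCLike.re_mul_ofReal]
    have := hc μ
    simp only [RCLike.conj_re]
    positivity
  refine ⟨P, fun x => K.norm_starProjection_apply_le x, hcomm, ?_, ?_⟩
  · refine ContinuousLinearMap.isPositive_def'.2 ⟨hTP, pos _ (fun μ => if 0 < RCLike.re μ then μ else 0) ?_ ?_⟩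
    · intro μ; split_ifs with h
      · exact h.le
      · simp
    · intro μ v hv; split_ifs with h
      · simp [hP1 μ h v hv, hTE μ v hv]
      · simp [hP0 μ h v hv]
  · refine ContinuousLinearMap.isPositive_def'.2 ⟨hTP.sub hT, pos _ (fun μ => if 0 < RCLike.re μ then 0 else -μ) ?_ ?_⟩
    · intro μ; split_ifs with h
      · simp
      · simpa using h
    · intro μ v hv; split_ifs with h
      · simp [hP1 μ h v hv]
      · simp [hP0 μ h v hv, hTE μ v hv]
end

theorem stmt_13 {𝕜 H : Type} [RCLike 𝕜] [NormedAddCommGroup H]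
    [InnerProductSpace 𝕜 H] [CompleteSpace H]
    (hinf : ¬ FiniteDimensional 𝕜 H) (x : ℕ → H) :
    ((∀ T S : H →L[𝕜] H, IsHilbertSchmidt T → IsHilbertSchmidt S →
        T.IsPositive → S.IsPositive →
        (∀ k, (inner 𝕜 (T (x k)) (x k) : 𝕜) = inner 𝕜 (S (x k)) (x k)) → T = S) ↔
      (∀ T S : H →L[𝕜] H, IsHilbertSchmidt T → IsHilbertSchmidt S →
        IsSelfAdjoint T → IsSelfAdjoint S →
        (∀ k, (inner 𝕜 (T (x k)) (x k) : 𝕜) = inner 𝕜 (S (x k)) (x k)) → T = S)) ∧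
    ((∀ T S : H →L[𝕜] H, IsHilbertSchmidt T → IsHilbertSchmidt S →
        IsSelfAdjoint T → IsSelfAdjoint S →
        (∀ k, (inner 𝕜 (T (x k)) (x k) : 𝕜) = inner 𝕜 (S (x k)) (x k)) → T = S) ↔
      (∀ T : H →L[𝕜] H, IsHilbertSchmidt T → IsSelfAdjoint T →
        (∀ k, (inner 𝕜 (T (x k)) (x k) : 𝕜) = 0) → T = 0)) := by
  have h23 : (∀ T S : H →L[𝕜] H, IsHilbertSchmidt T → IsHilbertSchmidt S →
        IsSelfAdjoint T → IsSelfAdjoint S →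
        (∀ k, (inner 𝕜 (T (x k)) (x k) : 𝕜) = inner 𝕜 (S (x k)) (x k)) → T = S) ↔
      (∀ T : H →L[𝕜] H, IsHilbertSchmidt T → IsSelfAdjoint T →
        (∀ k, (inner 𝕜 (T (x k)) (x k) : 𝕜) = 0) → T = 0) := by
    constructor
    · intro h T hT hTs h0
      obtain ⟨ι, e, he⟩ := hT
      exact h T 0 ⟨ι, e, he⟩ ⟨ι, e, by simp⟩ hTs (.zero _) (fun k => by simp [h0])
    · rintro h T S ⟨ι, e, he⟩ ⟨κ, f, hf⟩ hTs hSs h0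
      have hS := summable_other f e S hSs hf
      refine sub_eq_zero.1 (h (T - S) ⟨ι, e, ?_⟩ (hTs.sub hSs) fun k => by simp [inner_sub_left, h0])
      refine Summable.of_nonneg_of_le (fun i => by positivity) (fun i => ?_) ((he.add hS).mul_left 2)
      have h1 : ‖(T - S) (e i)‖ ≤ ‖T (e i)‖ + ‖S (e i)‖ := norm_sub_le _ _
      nlinarith [norm_nonneg ((T - S) (e i)), sq_nonneg (‖T (e i)‖ - ‖S (e i)‖), norm_nonneg (T (e i)), norm_nonneg (S (e i))]
  refine ⟨⟨fun h => h23.2 ?_, fun h T S hT hS hTp hSp => h T S hT hS hTp.isSelfAdjoint hSp.isSelfAdjoint⟩, h23⟩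
  rintro T ⟨ι, e, he⟩ hTs h0
  obtain ⟨P, hP, hcomm, p1, p2⟩ := decomp T hTs (hs_compact e T he)
  have hb : ∀ y, (T ∘L P) y = P (T y) := fun y => by rw [hcomm]; rfl
  have := h (T ∘L P) (T ∘L P - T) ⟨ι, e, ?_⟩ ⟨ι, e, ?_⟩ p1 p2 fun k => by
    rw [sub_apply, inner_sub_left, h0, sub_zero]
  · exact sub_eq_self.1 this.symm
  · refine Summable.of_nonneg_of_le (fun i => by positivity) (fun i => ?_) he
    rw [hb]
    gcongr
    exact hP _
  · refine Summable.of_nonneg_of_le (fun i => by positivity) (fun i => ?_) (he.mul_left 4)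
    rw [sub_apply, hb]
    have h1 := norm_sub_le (P (T (e i))) (T (e i))
    have h2 := hP (T (e i))
    nlinarith [norm_nonneg (P (T (e i)) - T (e i))]
end

section
/- Let {x_k}_{k=1}^∞ be a frame for an infinite-dimensional real or complex Hilbert space H. The following are equivalent: (1) {x_k}_{k=1}^∞ is injective; (2) for every orthonormal basis {e_j}_{j=1}^∞ of H, the closed linear span in ℓ₂ of the sequences (|⟨x_k, e_1⟩|², |⟨x_k, e_2⟩|², …) for k = 1, 2, … equals all of ℓ₂. -/
section helpers

open InnerProductSpace Filter Topology

theorem aux_parseval {𝕜 H ι : Type*} [RCLike 𝕜] [NormedAddCommGroup H]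
    [InnerProductSpace 𝕜 H] (b : HilbertBasis ι 𝕜 H) (v : H) :
    HasSum (fun i => ‖(inner 𝕜 (b i) v : 𝕜)‖ ^ 2) (‖v‖ ^ 2) := by
  have h := b.hasSum_inner_mul_inner v v
  rw [← RCLike.hasSum_ofReal (𝕜 := 𝕜)]
  convert h using 1
  · ext i
    rw [← inner_conj_symm v (b i), RCLike.conj_mul]
    push_cast
    rfl
  · rw [inner_self_eq_norm_sq_to_K]
    push_cast
    rfl

theorem aux_summable {𝕜 H ι : Type*} [RCLike 𝕜] [NormedAddCommGroup H]
    [InnerProductSpace 𝕜 H] [CompleteSpace H] (e : HilbertBasis ι 𝕜 H) (g : ι → H)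
    (hg : Summable fun i => ‖g i‖ ^ 2) :
    Summable fun i => rankOne 𝕜 (g i) (e i) := by
  rw [summable_iff_vanishing_norm]
  intro ε hε
  obtain ⟨s, hs⟩ := (summable_iff_vanishing_norm.1 hg) ((ε / 2) ^ 2) (by positivity)
  refine ⟨s, fun t ht => ?_⟩
  have h1 := hs t ht
  rw [Real.norm_of_nonneg (Finset.sum_nonneg fun i _ => by positivity)] at h1
  refine lt_of_le_of_lt (ContinuousLinearMap.opNorm_le_bound _ (half_pos hε).le fun v => ?_)
    (half_lt_self hε)
  rw [ContinuousLinearMap.sum_apply]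
  have h2 : ‖∑ i ∈ t, rankOne 𝕜 (g i) (e i) v‖
      ≤ ∑ i ∈ t, ‖(inner 𝕜 (e i) v : 𝕜)‖ * ‖g i‖ := by
    refine (norm_sum_le _ _).trans (le_of_eq ?_)
    refine Finset.sum_congr rfl fun i _ => ?_
    rw [rankOne_apply, norm_smul]
  have h3 := Finset.sum_mul_sq_le_sq_mul_sq t (fun i => ‖(inner 𝕜 (e i) v : 𝕜)‖)
    (fun i => ‖g i‖)
  have h4 := e.orthonormal.sum_inner_products_le (s := t) v
  refine h2.trans (abs_le_of_sq_le_sq' ?_ (by positivity)).2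
  refine h3.trans ?_
  rw [mul_pow, mul_comm ((ε / 2) ^ 2)]
  exact mul_le_mul h4 h1.le (Finset.sum_nonneg fun i _ => by positivity) (by positivity)

theorem aux_hasSum {𝕜 H ι : Type*} [RCLike 𝕜] [NormedAddCommGroup H]
    [InnerProductSpace 𝕜 H] [CompleteSpace H] (e : HilbertBasis ι 𝕜 H) (T : H →L[𝕜] H)
    (hg : Summable fun i => ‖T (e i)‖ ^ 2) :
    HasSum (fun i => rankOne 𝕜 (T (e i)) (e i)) T := by
  obtain ⟨S, hS⟩ := aux_summable e _ hg
  have : S = T := by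
    ext v
    have h1 : HasSum (fun i => rankOne 𝕜 (T (e i)) (e i) v) (S v) :=
      hS.mapL (ContinuousLinearMap.apply 𝕜 H v)
    have h2 := (e.hasSum_repr v).mapL T
    refine h1.unique ?_
    convert h2 using 2 with i
    rw [rankOne_apply, map_smul, e.repr_apply_apply]
  exact this ▸ hS

theorem aux_compact {𝕜 H ι : Type*} [RCLike 𝕜] [NormedAddCommGroup H]
    [InnerProductSpace 𝕜 H] [CompleteSpace H] (e : HilbertBasis ι 𝕜 H) (T : H →L[𝕜] H)
    (hg : Summable fun i => ‖T (e i)‖ ^ 2) : IsCompactOperator T := by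
  refine isCompactOperator_of_tendsto (aux_hasSum e T hg) (Eventually.of_forall fun s => ?_)
  have : ∑ i ∈ s, rankOne 𝕜 (T (e i)) (e i) ∈ compactOperator (RingHom.id 𝕜) H H := by
    refine Submodule.sum_mem _ fun i _ => ?_
    change IsCompactOperator (rankOne 𝕜 (T (e i)) (e i))
    rw [rankOne_def']
    exact (isCompactOperator_of_locallyCompactSpace_dom (innerSL 𝕜 (e i))).clm_comp
      (ContinuousLinearMap.toSpanSingleton 𝕜 (T (e i)))
  exact this

theorem aux_hs {𝕜 H ι κ : Type*} [RCLike 𝕜] [NormedAddCommGroup H]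
    [InnerProductSpace 𝕜 H] [CompleteSpace H] (e : HilbertBasis ι 𝕜 H) (f : HilbertBasis κ 𝕜 H)
    (T : H →L[𝕜] H) (hT : IsSelfAdjoint T)
    (hg : Summable fun i => ‖T (e i)‖ ^ 2) : Summable fun i => ‖T (f i)‖ ^ 2 := by
  have key : ∀ {α : Type _} (b : HilbertBasis α 𝕜 H) (v : H),
      ENNReal.ofReal (‖v‖ ^ 2) = ∑' i, ENNReal.ofReal (‖(inner 𝕜 (b i) v : 𝕜)‖ ^ 2) := by
    intro α b v
    have := aux_parseval b v
    rw [← this.tsum_eq, ENNReal.ofReal_tsum_of_nonneg (fun i => by positivity) this.summable]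
  have keyB : ∀ {α : Type _} (b : HilbertBasis α 𝕜 H) (v : H),
      ENNReal.ofReal (‖v‖ ^ 2) = ∑' i, ENNReal.ofReal (‖(inner 𝕜 (b i) v : 𝕜)‖ ^ 2) := by
    intro α b v
    have := aux_parseval b v
    rw [← this.tsum_eq, ENNReal.ofReal_tsum_of_nonneg (fun i => by positivity) this.summable]
  have h1 : ∑' i, ENNReal.ofReal (‖T (e i)‖ ^ 2) = ∑' j, ENNReal.ofReal (‖T (f j)‖ ^ 2) := by
    simp_rw [key f (T (e _)), keyB e (T (f _))]
    rw [ENNReal.tsum_comm]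
    refine tsum_congr fun j => tsum_congr fun i => ?_
    have := hT.isSymmetric (f j) (e i)
    simp only [ContinuousLinearMap.coe_coe] at this
    rw [← this, norm_inner_symm]
  have h2 : ∑' i, ENNReal.ofReal (‖T (e i)‖ ^ 2) ≠ ⊤ := hg.tsum_ofReal_ne_top
  rw [h1] at h2
  have h3 := ENNReal.summable_toReal h2
  refine h3.congr fun j => ?_
  rw [ENNReal.toReal_ofReal (by positivity)]

theorem aux_quad {𝕜 H ι : Type*} [RCLike 𝕜] [NormedAddCommGroup H]
    [InnerProductSpace 𝕜 H] (e : HilbertBasis ι 𝕜 H) (c : ι → ℝ) (S : H →L[𝕜] H)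
    (hS : HasSum (fun i => rankOne 𝕜 ((c i : 𝕜) • e i) (e i)) S) (v : H) :
    HasSum (fun i => ((c i * ‖(inner 𝕜 v (e i) : 𝕜)‖ ^ 2 : ℝ) : 𝕜)) (inner 𝕜 (S v) v) := by
  have h1 : HasSum (fun i => rankOne 𝕜 ((c i : 𝕜) • e i) (e i) v) (S v) :=
    hS.mapL (ContinuousLinearMap.apply 𝕜 H v)
  have h2 := h1.mapL (innerSL 𝕜 v)
  have h3 := h2.star
  simp only [innerSL_apply_apply] at h3
  convert h3 using 1
  · ext i
    rw [rankOne_apply, inner_smul_right, inner_smul_right, ← inner_conj_symm (e i) v]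
    simp only [star_mul', RCLike.star_def, RCLike.conj_conj, RCLike.conj_ofReal]
    push_cast
    rw [← RCLike.mul_conj]
    ring
  · rw [RCLike.star_def, inner_conj_symm]

theorem aux_eigenbasis {𝕜 H : Type} [RCLike 𝕜] [NormedAddCommGroup H]
    [InnerProductSpace 𝕜 H] [CompleteSpace H] (T : H →L[𝕜] H)
    (hc : IsCompactOperator T) (hT : IsSelfAdjoint T) :
    ∃ (ι : Type) (f : HilbertBasis ι 𝕜 H) (c : ι → ℝ), ∀ i, T (f i) = (c i : 𝕜) • f i := by
  have hsym := hT.isSymmetric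
  have hbot := ContinuousLinearMap.orthogonalComplement_iSup_eigenspaces_eq_bot hc hsym
  have hfam := hsym.orthogonalFamily_eigenspaces
  have hcl : ∀ μ : 𝕜, CompleteSpace (Module.End.eigenspace (T : Module.End 𝕜 H) μ) := by
    intro μ
    have : IsClosed ((Module.End.eigenspace (T : Module.End 𝕜 H) μ : Submodule 𝕜 H) : Set H) := by
      have h : ((Module.End.eigenspace (T : Module.End 𝕜 H) μ : Submodule 𝕜 H) : Set H)
          = {v | T v = μ • v} := by
        ext v
        simp [Module.End.mem_eigenspace_iff]
      rw [h]
      exact isClosed_eq T.continuous (continuous_const_smul μ)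
    exact this.completeSpace_coe
  choose w b hb using fun μ : 𝕜 =>
    exists_hilbertBasis 𝕜 (Module.End.eigenspace (T : Module.End 𝕜 H) μ)
  have hon := hfam.orthonormal_sigma_orthonormal (v_family := fun μ => b μ)
    (fun μ => (b μ).orthonormal)
  have hspan : (Submodule.span 𝕜 (Set.range fun a : Σ μ : 𝕜, w μ =>
      (Module.End.eigenspace (T : Module.End 𝕜 H) a.1).subtypeₗᵢ (b a.1 a.2)))ᗮ = ⊥ := by
    rw [eq_bot_iff, ← hbot]
    intro v hv
    rw [Submodule.mem_orthogonal] at hv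
    rw [← Submodule.iInf_orthogonal, Submodule.mem_iInf]
    intro μ
    rw [Submodule.mem_orthogonal]
    intro u hu
    have h1 := (b μ).hasSum_repr ⟨u, hu⟩
    have h2 := h1.mapL (Module.End.eigenspace (T : Module.End 𝕜 H) μ).subtypeL
    have h3 := h2.mapL (innerSL 𝕜 v)
    have h4 : (inner 𝕜 v u : 𝕜) = 0 := by
      refine HasSum.unique h3 ?_
      convert hasSum_zero using 1
      ext i
      have := hv (b μ i) (Submodule.subset_span ⟨⟨μ, i⟩, rfl⟩)
      simp only [innerSL_apply_apply, map_smul, inner_smul_right]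
      have h5 := inner_eq_zero_symm.1 this
      simp [h5]
    exact inner_eq_zero_symm.1 h4
  refine ⟨_, HilbertBasis.mkOfOrthogonalEqBot hon hspan, fun a => RCLike.re a.1, fun a => ?_⟩
  rw [HilbertBasis.coe_mkOfOrthogonalEqBot]
  obtain ⟨μ, i⟩ := a
  have hmem := (b μ i).2
  have hne : ((b μ i : Module.End.eigenspace (T : Module.End 𝕜 H) μ) : H) ≠ 0 := by
    have := (b μ).orthonormal.ne_zero i
    simpa using this
  have hconj := hsym.conj_eigenvalue_eq_self
    (Module.End.hasEigenvalue_of_hasEigenvector ⟨hmem, hne⟩)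
  rw [RCLike.conj_eq_iff_re] at hconj
  simp only [hconj]
  exact Module.End.mem_eigenspace_iff.1 hmem

theorem aux_equiv {𝕜 H ι : Type} [RCLike 𝕜] [NormedAddCommGroup H]
    [InnerProductSpace 𝕜 H] [CompleteSpace H]
    (hinf : ¬ FiniteDimensional 𝕜 H) (x : ℕ → H)
    (hx : ∀ v : H, (∀ k, (inner 𝕜 v (x k) : 𝕜) = 0) → v = 0) (f : HilbertBasis ι 𝕜 H) :
    Nonempty (ℕ ≃ ι) := by
  have hi : Infinite ι := by
    by_contra h
    rw [not_infinite_iff_finite] at h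
    have := Fintype.ofFinite ι
    exact hinf (Module.Basis.finiteDimensional_of_finite f.toOrthonormalBasis.toBasis)
  have hcnt : Countable ι := by
    rw [← Set.countable_univ_iff]
    have : (Set.univ : Set ι) ⊆
        ⋃ k, Function.support fun i => ‖(inner 𝕜 (f i) (x k) : 𝕜)‖ ^ 2 := by
      intro i _
      by_contra h
      simp only [Set.mem_iUnion, Function.mem_support, not_exists, not_not] at h
      refine f.orthonormal.ne_zero i (hx _ fun k => ?_)
      simpa using h k
    refine Set.Countable.mono this (Set.countable_iUnion fun k => ?_)
    exact (aux_parseval f (x k)).summable.countable_support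
  exact (nonempty_denumerable ι).elim fun d => ⟨(Denumerable.eqv ι).symm⟩

theorem aux_reindex {𝕜 H ι : Type} [RCLike 𝕜] [NormedAddCommGroup H]
    [InnerProductSpace 𝕜 H] [CompleteSpace H] (f : HilbertBasis ι 𝕜 H) (σ : ℕ ≃ ι) :
    ∃ e : HilbertBasis ℕ 𝕜 H, ∀ j, e j = f (σ j) := by
  refine ⟨HilbertBasis.mk (v := f ∘ σ) (f.orthonormal.comp _ σ.injective) ?_, fun j => ?_⟩
  · rw [σ.surjective.range_comp, f.dense_span]
  · rw [HilbertBasis.coe_mk]; rfl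

theorem aux_mem {𝕜 H : Type} [RCLike 𝕜] [NormedAddCommGroup H]
    [InnerProductSpace 𝕜 H] (e : HilbertBasis ℕ 𝕜 H) (v : H) :
    ∃ a : lp (fun _ : ℕ => ℝ) 2, ∀ j, a j = ‖(inner 𝕜 v (e j) : 𝕜)‖ ^ 2 := by
  have h := aux_parseval e v
  have hm : Memℓp (fun j => ‖(inner 𝕜 v (e j) : 𝕜)‖ ^ 2 : ℕ → ℝ) 2 := by
    have h1 : Memℓp (fun j => ‖(inner 𝕜 v (e j) : 𝕜)‖ ^ 2 : ℕ → ℝ) 1 := by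
      rw [memℓp_gen_iff (by simp)]
      simpa [norm_inner_symm] using h.summable
    exact h1.of_exponent_ge (by norm_num)
  exact ⟨⟨_, hm⟩, fun j => rfl⟩

theorem aux_lp {c : ℕ → ℝ} : Memℓp c 2 ↔ Summable fun j => c j ^ 2 := by
  rw [memℓp_gen_iff (by simp)]
  simp

end helpers


/-- A frame `{x_k}_{k=1}^∞` for an infinite-dimensional real or
complex Hilbert space `H` is injective (for Hilbert–Schmidt self-adjoint
operators) if and only if for every orthonormal basis `{e_j}_{j=1}^∞` of `H`,
the closed linear span in `ℓ₂` of the sequences `(|⟨x_k, e_j⟩|²)_j`,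
`k = 1, 2, …`, is all of `ℓ₂`. -/
theorem stmt_14 {𝕜 H : Type} [RCLike 𝕜] [NormedAddCommGroup H]
    [InnerProductSpace 𝕜 H] [CompleteSpace H]
    (hinf : ¬ FiniteDimensional 𝕜 H) (x : ℕ → H)
    (hframe : ∃ A B : ℝ, 0 < A ∧ A ≤ B ∧ ∀ v : H,
      A * ‖v‖ ^ 2 ≤ ∑' k, ‖(inner 𝕜 v (x k) : 𝕜)‖ ^ 2 ∧
      ∑' k, ‖(inner 𝕜 v (x k) : 𝕜)‖ ^ 2 ≤ B * ‖v‖ ^ 2) :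
    ((∀ T : H →L[𝕜] H, IsHilbertSchmidt T → IsSelfAdjoint T →
        (∀ k, (inner 𝕜 (T (x k)) (x k) : 𝕜) = 0) → T = 0) ↔
      (∀ e : HilbertBasis ℕ 𝕜 H,
        (Submodule.span ℝ {a : lp (fun _ : ℕ => ℝ) 2 |
            ∃ k, ∀ j, a j = ‖(inner 𝕜 (x k) (e j) : 𝕜)‖ ^ 2}).topologicalClosure = ⊤)) := by
  have hx : ∀ v : H, (∀ k, (inner 𝕜 v (x k) : 𝕜) = 0) → v = 0 := by
    obtain ⟨A, B, hA, -, h⟩ := hframe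
    intro v hv
    have h1 := (h v).1
    simp only [hv, norm_zero] at h1
    simp only [ne_eq, OfNat.ofNat_ne_zero, not_false_eq_true, zero_pow, tsum_zero] at h1
    have h2 : ‖v‖ ^ 2 ≤ 0 := by
      by_contra h3
      push Not at h3
      exact absurd (mul_pos hA h3) (not_lt.2 h1)
    simpa using pow_eq_zero_iff (two_ne_zero) |>.1 (le_antisymm h2 (by positivity))
  constructor
  · intro hinj e
    rw [Submodule.topologicalClosure_eq_top_iff, Submodule.eq_bot_iff]
    intro c hc
    rw [Submodule.mem_orthogonal] at hc
    have hcs : Summable fun j => c j ^ 2 := aux_lp.1 c.2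
    have hg : Summable fun j => ‖((c j : ℝ) : 𝕜) • e j‖ ^ 2 := by
      refine hcs.congr fun j => ?_
      rw [norm_smul, e.orthonormal.1 j]
      simp
    obtain ⟨S, hS⟩ := aux_summable e _ hg
    have hSe : ∀ j, S (e j) = ((c j : ℝ) : 𝕜) • e j := by
      intro j
      have h1 : HasSum (fun i => InnerProductSpace.rankOne 𝕜 (((c i : ℝ) : 𝕜) • e i) (e i) (e j))
          (S (e j)) := hS.mapL (ContinuousLinearMap.apply 𝕜 H (e j))
      refine h1.unique ?_
      convert hasSum_single j ?_ using 1
      · simp [InnerProductSpace.rankOne_apply, e.orthonormal.1 j]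
      · intro i hij
        rw [InnerProductSpace.rankOne_apply, e.orthonormal.2 hij, zero_smul]
    have hS0 : S = 0 := by
      refine hinj S ⟨ℕ, e, ?_⟩ ?_ ?_
      · simpa only [hSe] using hg
      · have h1 := hS.star
        have h2 : (fun i => star (InnerProductSpace.rankOne 𝕜 (((c i : ℝ) : 𝕜) • e i) (e i)))
            = fun i => InnerProductSpace.rankOne 𝕜 (((c i : ℝ) : 𝕜) • e i) (e i) := by
          ext i v
          rw [ContinuousLinearMap.star_eq_adjoint, InnerProductSpace.adjoint_rankOne]
          simp [InnerProductSpace.rankOne_apply, smul_smul, inner_smul_left, mul_comm]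
        rw [h2] at h1
        exact h1.unique hS
      · intro k
        obtain ⟨a, ha⟩ := aux_mem e (x k)
        have h1 := aux_quad e (fun j => c j) S hS (x k)
        have h2 := hc a (Submodule.subset_span ⟨k, ha⟩)
        have h3 := lp.hasSum_inner (𝕜 := ℝ) a c
        rw [h2] at h3
        refine h1.unique ?_
        rw [← RCLike.ofReal_zero, RCLike.hasSum_ofReal]
        refine (congrArg (fun F : ℕ → ℝ => HasSum F 0) (funext fun j => ?_)).mpr h3
        rw [ha j]
        simp
    ext j
    have h1 := hSe j
    rw [hS0] at h1
    have h2 := smul_eq_zero.1 h1.symm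
    simpa [e.orthonormal.ne_zero j] using h2
  · intro hsp T hHS hT h0
    obtain ⟨κ, b, hb⟩ := hHS
    obtain ⟨ι, f, cc, hf⟩ := aux_eigenbasis T (aux_compact b T hb) hT
    obtain ⟨σ⟩ := aux_equiv hinf x hx f
    obtain ⟨e, he⟩ := aux_reindex f σ
    have hTe : ∀ j, T (e j) = ((cc (σ j) : ℝ) : 𝕜) • e j := fun j => by rw [he, hf]
    have hsum := aux_hs b e T hT hb
    have hcs : Summable fun j => cc (σ j) ^ 2 := by
      refine hsum.congr fun j => ?_
      rw [hTe, norm_smul, e.orthonormal.1 j]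
      simp
    have hTs := aux_hasSum e T hsum
    simp only [hTe] at hTs
    let c : lp (fun _ : ℕ => ℝ) 2 := ⟨fun j => cc (σ j), aux_lp.2 hcs⟩
    have hcj : ∀ j, c j = cc (σ j) := fun j => rfl
    have hs := hsp e
    rw [Submodule.topologicalClosure_eq_top_iff, Submodule.eq_bot_iff] at hs
    have hc0 : c = 0 := by
      refine hs c ?_
      have hle : Submodule.span ℝ {a : lp (fun _ : ℕ => ℝ) 2 |
          ∃ k, ∀ j, a j = ‖(inner 𝕜 (x k) (e j) : 𝕜)‖ ^ 2} ≤ (Submodule.span ℝ {c})ᗮ := by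
        rw [Submodule.span_le]
        rintro a ⟨k, ha⟩
        rw [SetLike.mem_coe, Submodule.mem_orthogonal_singleton_iff_inner_left]
        have h1 := aux_quad e (fun j => cc (σ j)) T hTs (x k)
        rw [h0 k, ← RCLike.ofReal_zero, RCLike.hasSum_ofReal] at h1
        refine (lp.hasSum_inner (𝕜 := ℝ) a c).unique ?_
        refine (congrArg (fun F : ℕ → ℝ => HasSum F 0) (funext fun j => ?_)).mpr h1
        rw [ha j, hcj]
        simp
      rw [Submodule.mem_orthogonal]
      intro u hu
      exact Submodule.mem_orthogonal_singleton_iff_inner_left.1 (hle hu)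
    refine hTs.unique ?_
    have hz : ∀ j, cc (σ j) = 0 := fun j => by rw [← hcj, hc0]; rfl
    simp [hz]
end
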